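/- Let q be a prime power, K a finite field with q elements, K̄ an algebraic closure of K, and φ the Frobenius map on P¹(K̄) given by [a : b] ↦ [a^q : b^q]. The number of ordered 6-tuples (x₁, …, x₆) of pairwise distinct points of P¹(K̄) satisfying φ(x₁) = x₂, φ(x₂) = x₁, φ(x₃) = x₄, φ(x₄) = x₃, φ(x₅) = x₆ and φ(x₆) = x₅ equals (q² − q)(q² − q − 2)(q² − q − 4). -/

import Mathlib

open Projectivization

/-- The Frobenius map on the projective line `P¹(L)`, acting in homogeneous coordinates by
`[a : b] ↦ [a ^ q : b ^ q]`. -/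
noncomputable def frobP1 {L : Type*} [Field L] (q : ℕ)
    (x : Projectivization L (Fin 2 → L)) : Projectivization L (Fin 2 → L) :=
  Projectivization.mk L (fun i => (x.rep i) ^ q) (by
    intro hzero
    obtain ⟨i, hi⟩ := Function.ne_iff.mp x.rep_nonzero
    have h2 : x.rep i ^ q = 0 := congrFun hzero i
    exact hi (by simpa using (pow_eq_zero_iff'.mp h2).1))

section FrobeniusProjectiveLine

variable {L : Type*} [Field L]

theorem frobP1_mk (q : ℕ) (v : Fin 2 → L) (hv : v ≠ 0) (hv' : (fun i => v i ^ q) ≠ 0) :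
    frobP1 q (Projectivization.mk L v hv) = Projectivization.mk L (fun i => v i ^ q) hv' := by
  obtain ⟨c, hc⟩ := Projectivization.exists_smul_eq_mk_rep L v hv
  rw [frobP1, Projectivization.mk_eq_mk_iff']
  refine ⟨(c : L) ^ q, ?_⟩
  ext i
  simp [← hc, Units.smul_def, mul_pow]

/-- The point `[a : 1]` of the projective line. -/
def affinePoint (a : L) : Projectivization L (Fin 2 → L) :=
  Projectivization.mk L ![a, 1] (fun h => one_ne_zero (congrFun h 1))

theorem affinePoint_injective : Function.Injective (affinePoint (L := L)) := by
  intro a b h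
  obtain ⟨c, hc⟩ := (Projectivization.mk_eq_mk_iff' ..).1 h
  have h0 := congrFun hc 0
  have h1 := congrFun hc 1
  simp_all

theorem frobP1_affinePoint (q : ℕ) (a : L) :
    frobP1 q (affinePoint a) = affinePoint (a ^ q) := by
  have h : (fun i => (![a, 1] : Fin 2 → L) i ^ q) = ![a ^ q, 1] := by
    ext i
    fin_cases i <;> simp
  rw [affinePoint, frobP1_mk (hv' := fun h => one_ne_zero ((one_pow q).symm.trans (congrFun h 1)))]
  simp only [h, affinePoint]

theorem exists_affinePoint_eq {q : ℕ} (hq : q ≠ 0) {x : Projectivization L (Fin 2 → L)}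
    (hx : frobP1 q x ≠ x) : ∃ a, affinePoint a = x := by
  induction x using Projectivization.ind with
  | h v hv =>
    by_cases h1 : v 1 = 0
    · have h0 : v 0 ≠ 0 := fun h0 => hv (by ext i; fin_cases i <;> simp [h0, h1])
      refine absurd ?_ hx
      rw [frobP1_mk (hv' := fun h => pow_ne_zero q h0 (congrFun h 0)),
        Projectivization.mk_eq_mk_iff']
      refine ⟨v 0 ^ q / v 0, ?_⟩
      ext i
      fin_cases i <;> simp [h0, h1, hq]
    · refine ⟨v 0 / v 1, ?_⟩
      rw [affinePoint, Projectivization.mk_eq_mk_iff']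
      refine ⟨(v 1)⁻¹, ?_⟩
      ext i
      fin_cases i <;> simp [h1, div_eq_inv_mul]

end FrobeniusProjectiveLine

theorem card_toFinset_roots_X_pow_card_pow_sub_X {K L : Type*} [Field K] [Fintype K] [Field L]
    [DecidableEq L] [Algebra K L] [IsAlgClosed L] {n : ℕ} (hn : n ≠ 0) :
    ((Polynomial.X ^ (Fintype.card K ^ n) - Polynomial.X : Polynomial L).roots.toFinset).card
      = Fintype.card K ^ n := by
  obtain ⟨p, hp⟩ := CharP.exists K
  have hL : CharP L p := charP_of_injective_algebraMap (algebraMap K L).injective p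
  obtain ⟨m, hp', hm⟩ := FiniteField.card K p
  have hlt : 1 < Fintype.card K ^ n := Nat.one_lt_pow hn Fintype.one_lt_card
  have hsep : (Polynomial.X ^ (Fintype.card K ^ n) - Polynomial.X : Polynomial L).Separable :=
    galois_poly_separable p _ (hm ▸ dvd_pow (dvd_pow_self p m.ne_zero) hn)
  rw [Multiset.toFinset_card_of_nodup (Polynomial.nodup_roots hsep),
    ← (IsAlgClosed.splits _).natDegree_eq_card_roots,
    FiniteField.X_pow_card_sub_X_natDegree_eq _ hlt]

theorem exists_finset_frobP1_period_two {K L : Type*} [Field K] [Fintype K] [Field L]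
    [Algebra K L] [IsAlgClosed L] :
    ∃ S : Finset (Projectivization L (Fin 2 → L)),
      (∀ x, x ∈ S ↔ frobP1 (Fintype.card K) (frobP1 (Fintype.card K) x) = x ∧
        frobP1 (Fintype.card K) x ≠ x) ∧
      (S.card : ℤ) = (Fintype.card K : ℤ) ^ 2 - (Fintype.card K : ℤ) := by
  classical
  set q := Fintype.card K with hq
  have hq1 : 1 < q := Fintype.one_lt_card
  have hmem {n : ℕ} (hn : n ≠ 0) (a : L) :
      a ∈ (Polynomial.X ^ (q ^ n) - Polynomial.X : Polynomial L).roots.toFinset ↔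
        a ^ q ^ n = a := by
    rw [Multiset.mem_toFinset, Polynomial.mem_roots
      (FiniteField.X_pow_card_sub_X_ne_zero _ (Nat.one_lt_pow hn hq1))]
    simp [sub_eq_zero]
  have hsub : (Polynomial.X ^ (q ^ 1) - Polynomial.X : Polynomial L).roots.toFinset ⊆
      (Polynomial.X ^ (q ^ 2) - Polynomial.X : Polynomial L).roots.toFinset := by
    intro a ha
    rw [hmem one_ne_zero, pow_one] at ha
    rw [hmem two_ne_zero, pow_two, pow_mul, ha, ha]
  refine ⟨((Polynomial.X ^ (q ^ 2) - Polynomial.X : Polynomial L).roots.toFinset \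
    (Polynomial.X ^ (q ^ 1) - Polynomial.X : Polynomial L).roots.toFinset).map
      ⟨affinePoint, affinePoint_injective⟩, fun x => ?_, ?_⟩
  · have key (a : L) : (a ^ q ^ 2 = a ∧ ¬ a ^ q ^ 1 = a) ↔
        frobP1 q (frobP1 q (affinePoint a)) = affinePoint a ∧
          frobP1 q (affinePoint a) ≠ affinePoint a := by
      simp only [frobP1_affinePoint, affinePoint_injective.eq_iff, ne_eq, pow_one, pow_two,
        pow_mul]
    simp only [Finset.mem_map, Finset.mem_sdiff, hmem one_ne_zero, hmem two_ne_zero, key,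
      Function.Embedding.coeFn_mk]
    constructor
    · rintro ⟨a, ha, rfl⟩
      exact ha
    · intro h
      obtain ⟨a, rfl⟩ := exists_affinePoint_eq (by omega) h.2
      exact ⟨a, h, rfl⟩
  · rw [Finset.card_map, Finset.cast_card_sdiff hsub,
      card_toFinset_roots_X_pow_card_pow_sub_X two_ne_zero,
      card_toFinset_roots_X_pow_card_pow_sub_X one_ne_zero]
    simp [hq]

theorem card_injective_three_two_cycles {X : Type*} (f : X → X) (S : Finset X)
    (hS : ∀ x, x ∈ S ↔ f (f x) = x ∧ f x ≠ x) :
    (Nat.card {x : Fin 6 → X // Function.Injective x ∧ f (x 0) = x 1 ∧ f (x 1) = x 0 ∧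
      f (x 2) = x 3 ∧ f (x 3) = x 2 ∧ f (x 4) = x 5 ∧ f (x 5) = x 4} : ℤ)
    = (S.card : ℤ) * (S.card - 2) * (S.card - 4) := by
  classical
  let T : Finset (Σ _ : X, Σ _ : X, X) := S.sigma fun a => (S \ {a, f a}).sigma fun b =>
    S \ {a, f a, b, f b}
  have hT : (T.card : ℤ) = (S.card : ℤ) * (S.card - 2) * (S.card - 4) := by
    have hfS {a : X} (ha : a ∈ S) : f a ∈ S := by
      rw [hS] at ha ⊢
      grind
    have h2 {a : X} (ha : a ∈ S) : ((S \ {a, f a}).card : ℤ) = S.card - 2 := by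
      rw [Finset.cast_card_sdiff (by grind), Finset.card_pair ((hS a).1 ha).2.symm]
      rfl
    have h4 {a b : X} (ha : a ∈ S) (hb : b ∈ S \ {a, f a}) :
        ((S \ {a, f a, b, f b}).card : ℤ) = S.card - 4 := by
      have hcard : ({a, f a, b, f b} : Finset X).card = 4 := by
        have := (hS a).1 ha
        have := (hS b).1 (Finset.mem_sdiff.1 hb).1
        rw [Finset.card_insert_of_notMem, Finset.card_insert_of_notMem, Finset.card_pair] <;>
          grind
      rw [Finset.cast_card_sdiff (by grind), hcard]
      rfl
    simp only [T, Finset.card_sigma, Nat.cast_sum]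
    rw [Finset.sum_congr rfl fun a ha => Finset.sum_congr rfl fun b hb => h4 ha hb]
    simp only [Finset.sum_const, nsmul_eq_mul]
    rw [Finset.sum_congr rfl fun a ha => by rw [h2 ha]]
    simp [mul_assoc]
  rw [← hT, ← Fintype.card_coe T, ← Nat.card_eq_fintype_card]
  congr 1
  refine Nat.card_congr
    { toFun := fun x => ⟨⟨x.1 0, x.1 2, x.1 4⟩, ?_⟩
      invFun := fun t => ⟨![t.1.1, f t.1.1, t.1.2.1, f t.1.2.1, t.1.2.2, f t.1.2.2], ?_⟩
      left_inv := ?_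
      right_inv := fun t => rfl }
  · obtain ⟨x, hx, h0, h1, h2, h3, h4, h5⟩ := x
    simp only [T, Finset.mem_sigma, Finset.mem_sdiff, hS, Finset.mem_insert,
      Finset.mem_singleton, h0, h1, h2, h3, h4, h5, hx.eq_iff, ne_eq]
    decide
  · obtain ⟨⟨a, b, c⟩, ht⟩ := t
    simp only [T, Finset.mem_sigma, Finset.mem_sdiff, hS, Finset.mem_insert,
      Finset.mem_singleton, not_or] at ht
    obtain ⟨⟨ha, ha'⟩, ⟨⟨hb, hb'⟩, hba, hba'⟩, ⟨hc, hc'⟩, hca, hca', hcb, hcb'⟩ := ht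
    refine ⟨?_, rfl, ha, rfl, hb, rfl, hc⟩
    intro i j hij
    fin_cases i <;> fin_cases j <;> simp at hij ⊢ <;> grind
  · rintro ⟨x, hx, h0, h1, h2, h3, h4, h5⟩
    ext i
    fin_cases i <;> simp [h0, h2, h4]

/-- the number of injective 6-tuples of points of `P¹(K̄)`
satisfying the stated Frobenius conditions. -/
theorem statement16 (q : ℕ) (hq : IsPrimePow q)
    (K : Type*) [Field K] [Fintype K] (hK : Fintype.card K = q) :
    (Nat.card
      {x : Fin 6 → Projectivization (AlgebraicClosure K) (Fin 2 → AlgebraicClosure K) //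
        Function.Injective x ∧
        frobP1 q (x 0) = x 1 ∧
        frobP1 q (x 1) = x 0 ∧
        frobP1 q (x 2) = x 3 ∧
        frobP1 q (x 3) = x 2 ∧
        frobP1 q (x 4) = x 5 ∧
        frobP1 q (x 5) = x 4} : ℤ)
    = ((q : ℤ) ^ 2 - (q : ℤ)) * ((q : ℤ) ^ 2 - (q : ℤ) - 2) * ((q : ℤ) ^ 2 - (q : ℤ) - 4) := by
  obtain ⟨S, hS, hcard⟩ := exists_finset_frobP1_period_two (K := K) (L := AlgebraicClosure K)
  rw [hK] at hS hcard
  rw [card_injective_three_two_cycles (frobP1 q) S hS, hcard]
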